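/- If α is a real constant with 0 < α < 1, then lim_{n→∞} |Λ_n(⌊αn⌋)| / n! = 2α − 2α². -/

import Mathlib

open Finset

namespace Secretary

/-- Relative rank of `x` with regard to `P`: the number of `z ∈ P` with `z ≤ x`
(as an integer, so that differences can be computed in `ℤ`). -/
def rr {n : ℕ} (P : Finset (Fin n)) (x : Fin n) : ℤ :=
  ((P.filter fun z => z ≤ x).card : ℤ)

/-- `Δ(k) = {-1, 1, k-1, 1-k} ⊆ ℤ`. -/
def Δ (k : ℕ) : Finset ℤ := {-1, 1, (k : ℤ) - 1, 1 - (k : ℤ)}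

/-- `{x, y} ∈ Adj(P)`: both belong to `P` and the difference of their relative
ranks with regard to `P` (in one of the two orders) lies in `Δ(|P|)`. -/
def Adj {n : ℕ} (P : Finset (Fin n)) (x y : Fin n) : Prop :=
  x ∈ P ∧ y ∈ P ∧ (rr P x - rr P y ∈ Δ P.card ∨ rr P y - rr P x ∈ Δ P.card)

instance {n : ℕ} (P : Finset (Fin n)) (x y : Fin n) : Decidable (Adj P x y) := by
  unfold Adj; infer_instance

/-- `Ω n`: the sequences of `n` distinct applicants (as injective, hence
bijective, functions `Fin n → Fin n`); `|Ω n| = n!`. -/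
def Ω (n : ℕ) : Finset (Fin n → Fin n) :=
  Finset.univ.filter Function.Injective

/-- The `i`-th applicant of the sequence `x`, with the 1-based indexing
`x_1, …, x_n` of the paper. -/
def get {n : ℕ} [NeZero n] (x : Fin n → Fin n) (i : ℕ) : Fin n :=
  x ⟨(i - 1) % n, Nat.mod_lt _ (Nat.pos_of_ne_zero (NeZero.ne n))⟩

/-- The set `{x_1, …, x_i}` of the first `i` applicants of the sequence `x`. -/
def pre {n : ℕ} (x : Fin n → Fin n) (i : ℕ) : Finset (Fin n) :=
  (Finset.univ.filter fun j : Fin n => (j : ℕ) < i).image x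

/-- `Λ_n(r,k)`: sequences `x ∈ Ω_n` with `{x_k, x_{k+1}} ∈ Adj(C_n)` and
`{x_{i-1}, x_i} ∉ Adj({x_1,…,x_i})` for all `i ∈ {r,…,k}`. -/
def Lam : (n : ℕ) → ℕ → ℕ → Finset (Fin n → Fin n)
  | 0, _, _ => ∅
  | (m + 1), r, k =>
      (Ω (m + 1)).filter fun x =>
        Adj Finset.univ (get x k) (get x (k + 1)) ∧
          ∀ i, i ≤ k → r ≤ i → ¬ Adj (pre x i) (get x (i - 1)) (get x i)

/-- `Λ_n(r) = ⋃_{k=r}^{n-1} Λ_n(r,k)`. -/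
def LamU (n : ℕ) (r : ℕ) : Finset (Fin n → Fin n) :=
  (Finset.Icc r (n - 1)).biUnion fun k => Lam n r k

/-- `Π_n(r)`: those `x ∈ Λ_n(r)` such that for the (unique) `k` with
`x ∈ Λ_n(r,k)` one has `rr_n(x_k) - rr_n(x_{k+1}) ∈ {1-n, n-1}`. -/
def Pi' : (n : ℕ) → ℕ → Finset (Fin n → Fin n)
  | 0, _ => ∅
  | (m + 1), r =>
      (LamU (m + 1) r).filter fun x =>
        ∃ k ∈ Finset.Icc r m, x ∈ Lam (m + 1) r k ∧
          rr Finset.univ (get x k) - rr Finset.univ (get x (k + 1)) ∈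
            ({1 - ((m : ℤ) + 1), ((m : ℤ) + 1) - 1} : Finset ℤ)

/-- `Λ_n(r,k,z,z̄)`: sequences of `Λ_n(r,k)` with `x_k = z` and `x_{k+1} = z̄`. -/
def Lam4 : (n : ℕ) → ℕ → ℕ → Fin n → Fin n → Finset (Fin n → Fin n)
  | 0, _, _, z, _ => z.elim0
  | (m + 1), r, k, z, w =>
      (Lam (m + 1) r k).filter fun x => get x k = z ∧ get x (k + 1) = w

/-- Averaging over transpositions: for a family `B` stable under exchanging the value at `q` with
the values at positions in `M`. -/
lemma card_filter_mul_card {n : ℕ} (B : Finset (Fin n → Fin n)) (M : Finset (Fin n)) (q : Fin n)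
    (hB : ∀ x ∈ B, ∀ m ∈ M, x ∘ Equiv.swap m q ∈ B)
    (Q : (Fin n → Fin n) → Prop) [DecidablePred Q] :
    (B.filter Q).card * M.card
      = ∑ x ∈ B, (M.filter fun m => Q (x ∘ Equiv.swap m q)).card := by
  simp only [Finset.card_filter]
  rw [Finset.sum_comm, mul_comm, ← smul_eq_mul, ← Finset.sum_const]
  refine Finset.sum_congr rfl fun m hm => ?_
  have hinv : ∀ x : Fin n → Fin n, (x ∘ Equiv.swap m q) ∘ Equiv.swap m q = x := by
    intro x; funext i; simp
  refine Finset.sum_bij' (fun x _ => x ∘ Equiv.swap m q) (fun x _ => x ∘ Equiv.swap m q)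
    (fun x hx => hB x hx m hm) (fun x hx => hB x hx m hm) (fun x _ => hinv x)
    (fun x _ => hinv x) fun x _ => ?_
  rw [hinv]

lemma rr_lt_rr {n : ℕ} {P : Finset (Fin n)} {x y : Fin n} (hy : y ∈ P) (h : x < y) :
    rr P x < rr P y := by
  unfold rr
  norm_cast
  apply Finset.card_lt_card
  refine Finset.ssubset_iff_subset_ne.2 ⟨fun z hz => ?_, fun he => ?_⟩
  · simp only [Finset.mem_filter] at hz ⊢
    exact ⟨hz.1, hz.2.trans h.le⟩
  · have : y ∈ P.filter fun z => z ≤ x := by rw [he]; simp [hy]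
    simp only [Finset.mem_filter] at this
    exact absurd this.2 (not_le.2 h)

lemma rr_injOn {n : ℕ} (P : Finset (Fin n)) : Set.InjOn (rr P) P := by
  intro x hx y hy h
  rcases lt_trichotomy x y with h' | h' | h'
  · exact absurd h (rr_lt_rr hy h').ne
  · exact h'
  · exact absurd h (rr_lt_rr hx h').ne'

lemma rr_mem_Icc {n : ℕ} {P : Finset (Fin n)} {x : Fin n} (hx : x ∈ P) :
    rr P x ∈ Finset.Icc (1 : ℤ) P.card := by
  rw [Finset.mem_Icc]
  unfold rr
  norm_cast
  exact ⟨Finset.card_pos.2 ⟨x, by simp [hx]⟩, Finset.card_filter_le _ _⟩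

lemma image_rr {n : ℕ} (P : Finset (Fin n)) : P.image (rr P) = Finset.Icc (1 : ℤ) P.card := by
  apply Finset.eq_of_subset_of_card_le
  · intro t ht
    obtain ⟨x, hx, rfl⟩ := Finset.mem_image.1 ht
    exact rr_mem_Icc hx
  · rw [Finset.card_image_of_injOn (rr_injOn P)]
    simp

lemma adj_iff {n : ℕ} {P : Finset (Fin n)} {x y : Fin n} (hx : x ∈ P) (hy : y ∈ P) :
    Adj P x y ↔ rr P y - rr P x ∈ Δ P.card := by
  unfold Adj Δ
  simp only [hx, hy, true_and, Finset.mem_insert, Finset.mem_singleton]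
  omega

lemma adj_comm {n : ℕ} {P : Finset (Fin n)} {x y : Fin n} : Adj P x y ↔ Adj P y x := by
  unfold Adj
  tauto

lemma card_filter_sub_mem_Δ {k : ℕ} (hk : 3 ≤ k) {s : ℤ} (hs : s ∈ Finset.Icc (1 : ℤ) k) :
    ((Finset.Icc (1 : ℤ) k).filter fun t => t - s ∈ Δ k).card = 2 := by
  rw [Finset.mem_Icc] at hs
  rw [Finset.card_eq_two]
  refine ⟨if s = 1 then (k : ℤ) else s - 1, if s = k then 1 else s + 1, ?_, ?_⟩
  · split_ifs <;> omega
  · ext t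
    simp only [Δ, Finset.mem_filter, Finset.mem_Icc, Finset.mem_insert, Finset.mem_singleton]
    split_ifs <;> omega

lemma card_filter_adj {n : ℕ} {P : Finset (Fin n)} (hP : 3 ≤ P.card) {x : Fin n} (hx : x ∈ P) :
    (P.filter fun y => Adj P x y).card = 2 := by
  rw [← card_filter_sub_mem_Δ hP (rr_mem_Icc hx), ← image_rr P, Finset.filter_image,
    Finset.card_image_of_injOn ((rr_injOn P).mono fun y hy => (Finset.mem_filter.1 hy).1)]
  congr 1
  exact Finset.filter_congr fun y hy => adj_iff hx hy

lemma not_adj_self {n : ℕ} {P : Finset (Fin n)} (hP : 3 ≤ P.card) (x : Fin n) :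
    ¬ Adj P x x := by
  unfold Adj Δ
  simp only [Finset.mem_insert, Finset.mem_singleton]
  omega

lemma card_filter_positions {n : ℕ} {x : Fin n → Fin n} (hx : Function.Injective x)
    (M : Finset (Fin n)) {p : Fin n} (hp : p ∉ M) (hM : 2 ≤ M.card) :
    (M.filter fun m => Adj ((insert p M).image x) (x m) (x p)).card = 2 := by
  set P := (insert p M).image x with hPdef
  have hc : P.card = M.card + 1 := by
    rw [hPdef, Finset.card_image_of_injective _ hx, Finset.card_insert_of_notMem hp]
  have hpP : x p ∈ P := Finset.mem_image_of_mem _ (Finset.mem_insert_self _ _)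
  rw [← card_filter_adj (by omega) hpP, ← Finset.card_image_of_injective _ hx]
  congr 1
  ext y
  simp only [Finset.mem_image, Finset.mem_filter]
  constructor
  · rintro ⟨m, ⟨hm, ha⟩, rfl⟩
    exact ⟨ha.1, adj_comm.1 ha⟩
  · rintro ⟨hy, ha⟩
    obtain ⟨m, hm, rfl⟩ := Finset.mem_image.1 hy
    rcases Finset.mem_insert.1 hm with rfl | hm
    · exact absurd ha (not_adj_self (by omega) _)
    · exact ⟨m, ⟨hm, adj_comm.1 ha⟩, rfl⟩

lemma rr_univ {n : ℕ} (x : Fin n) : rr Finset.univ x = (x : ℤ) + 1 := by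
  unfold rr
  rw [Finset.filter_ge_eq_Iic]
  simp

lemma Adj.of_univ {n : ℕ} {P : Finset (Fin n)} {a b : Fin n} (h : Adj Finset.univ a b)
    (ha : a ∈ P) (hb : b ∈ P) : Adj P a b := by
  wlog hab : a ≤ b generalizing a b
  · exact adj_comm.1 (this (adj_comm.1 h) hb ha (le_of_not_ge hab))
  rw [adj_iff ha hb]
  rw [adj_iff (Finset.mem_univ _) (Finset.mem_univ _), rr_univ, rr_univ] at h
  simp only [Δ, Finset.card_univ, Fintype.card_fin, Finset.mem_insert, Finset.mem_singleton]
    at h ⊢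
  have hab' : (a : ℕ) ≤ b := hab
  have ha' := a.2
  have hb' := b.2
  have hcases : (b : ℕ) = a + 1 ∨ ((a : ℕ) = 0 ∧ (b : ℕ) + 1 = n) := by omega
  rcases hcases with h1 | ⟨h1, h2⟩
  · have : P.filter (fun z => z ≤ b) = insert b (P.filter fun z => z ≤ a) := by
      ext z
      simp only [Finset.mem_filter, Finset.mem_insert, Fin.le_def, Fin.ext_iff]
      constructor
      · rintro ⟨hz, hle⟩
        by_cases hzb : (z : ℕ) = b
        · exact Or.inl hzb
        · exact Or.inr ⟨hz, by omega⟩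
      · rintro (hz | ⟨hz, hle⟩)
        · obtain rfl : z = b := Fin.ext hz
          exact ⟨hb, le_rfl⟩
        · exact ⟨hz, by omega⟩
    have hcard : rr P b = rr P a + 1 := by
      unfold rr
      rw [this, Finset.card_insert_of_notMem]
      · push_cast; ring
      · simp only [Finset.mem_filter, Fin.le_def]
        omega
    omega
  · have hPb : rr P b = P.card := by
      unfold rr
      rw [Finset.filter_true_of_mem]
      intro z _
      rw [Fin.le_def]
      omega
    have hPa : rr P a = 1 := by
      unfold rr
      have : P.filter (fun z => z ≤ a) = {a} := by
        ext z
        simp only [Finset.mem_filter, Finset.mem_singleton, Fin.le_def, Fin.ext_iff]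
        constructor
        · rintro ⟨_, hle⟩
          omega
        · intro hz
          obtain rfl : z = a := Fin.ext hz
          exact ⟨ha, le_rfl⟩
      rw [this]
      simp
    omega

lemma mem_Ω {n : ℕ} {x : Fin n → Fin n} : x ∈ Ω n ↔ Function.Injective x := by
  simp [Ω]

lemma card_Ω (n : ℕ) : (Ω n).card = n.factorial := by
  have : Fintype.card (Fin n ↪ Fin n) = n.factorial := by
    rw [Fintype.card_embedding_eq]
    simp [Nat.descFactorial_self]
  rw [← this, ← Fintype.card_congr (Equiv.subtypeInjectiveEquivEmbedding (Fin n) (Fin n)),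
    Fintype.card_subtype]
  rfl

lemma get_eq {m i : ℕ} (x : Fin (m + 1) → Fin (m + 1)) (h : i - 1 < m + 1) :
    get x i = x ⟨i - 1, h⟩ := by
  unfold get
  congr 1
  exact Fin.ext (Nat.mod_eq_of_lt h)

lemma mem_Lam {m r k : ℕ} {x : Fin (m + 1) → Fin (m + 1)} :
    x ∈ Lam (m + 1) r k ↔ Function.Injective x ∧
      Adj Finset.univ (get x k) (get x (k + 1)) ∧
        ∀ i, i ≤ k → r ≤ i → ¬ Adj (pre x i) (get x (i - 1)) (get x i) := by
  simp [Lam, mem_Ω]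

lemma get_mem_pre {m i j : ℕ} (x : Fin (m + 1) → Fin (m + 1)) (hi : 1 ≤ i) (hij : i ≤ j)
    (him : i ≤ m + 1) : get x i ∈ pre x j := by
  rw [get_eq x (by omega)]
  refine Finset.mem_image_of_mem _ ?_
  simp only [Finset.mem_filter, Finset.mem_univ, true_and]
  omega

lemma card_Lam_self_succ {m k : ℕ} (hm : 2 ≤ m) (hk : 1 ≤ k) (hkm : k ≤ m) :
    (Lam (m + 1) (k + 1) k).card * m = 2 * (m + 1).factorial := by
  let q : Fin (m + 1) := ⟨k - 1, by omega⟩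
  let p : Fin (m + 1) := ⟨k, by omega⟩
  have hqp : q ≠ p := by
    simp only [ne_eq, Fin.ext_iff, q, p]
    omega
  have hL : Lam (m + 1) (k + 1) k
      = (Ω (m + 1)).filter fun x => Adj Finset.univ (x q) (x p) := by
    ext x
    rw [mem_Lam, Finset.mem_filter, mem_Ω, get_eq x (i := k) (by omega),
      get_eq x (i := k + 1) (by omega)]
    refine and_congr_right fun _ => and_iff_left ?_
    intro i h1 h2
    omega
  have key := card_filter_mul_card (Ω (m + 1)) (Finset.univ.erase p) q
    (fun x hx i _ => mem_Ω.2 ((mem_Ω.1 hx).comp (Equiv.injective _)))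
    (fun x => Adj Finset.univ (x q) (x p))
  rw [← hL] at key
  have hM : ((Finset.univ : Finset (Fin (m + 1))).erase p).card = m := by
    rw [Finset.card_erase_of_mem (Finset.mem_univ _)]
    simp
  rw [hM] at key
  rw [key, ← card_Ω, mul_comm, ← smul_eq_mul, ← Finset.sum_const]
  refine Finset.sum_congr rfl fun x hx => ?_
  have hx' := mem_Ω.1 hx
  rw [← card_filter_positions hx' (Finset.univ.erase p) (Finset.notMem_erase _ _) (by omega)]
  congr 1
  refine Finset.filter_congr fun i hi => ?_
  have hsurj : (insert p (Finset.univ.erase p)).image x = Finset.univ := by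
    rw [Finset.insert_erase (Finset.mem_univ _)]
    exact Finset.image_univ_of_surjective (Finite.surjective_of_injective hx')
  rw [hsurj]
  simp [Equiv.swap_apply_of_ne_of_ne (Finset.ne_of_mem_erase hi).symm hqp.symm]

lemma get_comp_swap {m i j : ℕ} (x : Fin (m + 1) → Fin (m + 1)) {a b : Fin (m + 1)}
    (ha : (a : ℕ) + 1 < j) (hb : (b : ℕ) + 1 < j) (hij : j ≤ i) (him : i ≤ m + 1) :
    get (x ∘ Equiv.swap a b) i = get x i := by
  rw [get_eq _ (by omega), get_eq _ (by omega), Function.comp_apply,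
    Equiv.swap_apply_of_ne_of_ne] <;> (rw [ne_eq, Fin.ext_iff]; simp only; omega)

lemma pre_comp_swap {n i : ℕ} (x : Fin n → Fin n) {a b : Fin n}
    (ha : (a : ℕ) < i) (hb : (b : ℕ) < i) :
    pre (x ∘ Equiv.swap a b) i = pre x i := by
  unfold pre
  rw [← Finset.image_image]
  congr 1
  apply Finset.eq_of_subset_of_card_le
  · intro c hc
    obtain ⟨d, hd, rfl⟩ := Finset.mem_image.1 hc
    simp only [Finset.mem_filter, Finset.mem_univ, true_and] at hd ⊢
    rw [Equiv.swap_apply_def]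
    split_ifs <;> assumption
  · rw [Finset.card_image_of_injective _ (Equiv.injective _)]

lemma card_Lam_step {m j k : ℕ} (hj : 3 ≤ j) (hjk : j ≤ k) (hkm : k ≤ m) :
    (Lam (m + 1) j k).card * (j - 1) = (j - 3) * (Lam (m + 1) (j + 1) k).card := by
  let q : Fin (m + 1) := ⟨j - 2, by omega⟩
  let p : Fin (m + 1) := ⟨j - 1, by omega⟩
  let M : Finset (Fin (m + 1)) := Finset.Iio p
  have hMc : M.card = j - 1 := by simp [M, p]
  have hpM : p ∉ M := by simp [M]
  have hM : ∀ i : Fin (m + 1), i ∈ M ↔ (i : ℕ) + 1 < j := by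
    intro i
    simp only [M, p, Finset.mem_Iio, Fin.lt_def]
    omega
  have hq : (q : ℕ) + 1 < j := by simp only [q]; omega
  have hqp : p ≠ q := by
    simp only [ne_eq, Fin.ext_iff, q, p]
    omega
  have hL : Lam (m + 1) j k
      = (Lam (m + 1) (j + 1) k).filter fun x => ¬ Adj (pre x j) (x q) (x p) := by
    ext x
    have h1 : get x (j - 1) = x q := get_eq x (by omega)
    have h2 : get x j = x p := get_eq x (by omega)
    rw [Finset.mem_filter, mem_Lam, mem_Lam, and_assoc, and_assoc]
    refine and_congr_right fun _ => and_congr_right fun _ => ?_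
    rw [← h1, ← h2]
    constructor
    · exact fun h => ⟨fun i hi hji => h i hi (by omega), h j hjk le_rfl⟩
    · rintro ⟨h, h'⟩ i hi hji
      rcases eq_or_lt_of_le hji with rfl | hlt
      · exact h'
      · exact h i hi hlt
  have key := card_filter_mul_card (Lam (m + 1) (j + 1) k) M q ?_
    (fun x => ¬ Adj (pre x j) (x q) (x p))
  · rw [← hL, hMc] at key
    rw [key, mul_comm, ← smul_eq_mul, ← Finset.sum_const]
    refine Finset.sum_congr rfl fun x hx => ?_
    have hx' := (mem_Lam.1 hx).1
    have hpre : pre x j = (insert p M).image x := by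
      unfold pre
      congr 1
      ext i
      simp only [Finset.mem_filter, Finset.mem_univ, true_and, Finset.mem_insert, hM,
        Fin.ext_iff, p]
      omega
    have h2 := card_filter_positions hx' M hpM (by omega)
    have hsum := Finset.card_filter_add_card_filter_not (s := M)
      (fun i => Adj ((insert p M).image x) (x i) (x p))
    have hcongr : (M.filter fun i => ¬ Adj (pre (x ∘ Equiv.swap i q) j)
          ((x ∘ Equiv.swap i q) q) ((x ∘ Equiv.swap i q) p))
        = M.filter fun i => ¬ Adj ((insert p M).image x) (x i) (x p) := by
      refine Finset.filter_congr fun i hi => ?_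
      have hi' := (hM i).1 hi
      have hpi : p ≠ i := fun h => hpM (h ▸ hi)
      rw [pre_comp_swap x (by omega) (by omega), hpre]
      simp [Equiv.swap_apply_of_ne_of_ne hpi hqp]
    rw [hcongr]
    omega
  · intro x hx i hi
    have hi' := (hM i).1 hi
    rw [mem_Lam] at hx ⊢
    refine ⟨hx.1.comp (Equiv.injective _), ?_, fun l hl hjl => ?_⟩
    · rw [get_comp_swap x hi' hq hjk (by omega),
        get_comp_swap x hi' hq (by omega) (by omega)]
      exact hx.2.1
    · rw [get_comp_swap x hi' hq (by omega) (by omega),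
        get_comp_swap x hi' hq (by omega) (by omega),
        pre_comp_swap x (by omega) (by omega)]
      exact hx.2.2 l hl hjl

lemma card_Lam {m r k : ℕ} (hr : 3 ≤ r) (hrk : r ≤ k + 1) (hk : 3 ≤ k) (hkm : k ≤ m) :
    (Lam (m + 1) r k).card * ((k - 1) * (k - 2) * m)
      = 2 * (m + 1).factorial * ((r - 2) * (r - 3)) := by
  induction hrk using Nat.decreasingInduction with
  | self =>
    have h := card_Lam_self_succ (m := m) (k := k) (by omega) (by omega) hkm
    rw [← h]
    have h1 : k + 1 - 2 = k - 1 := by omega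
    have h2 : k + 1 - 3 = k - 2 := by omega
    rw [h1, h2]
    ring
  | of_succ j hj ih =>
    have ih := ih (by omega)
    have hs := card_Lam_step hr (by omega : j ≤ k) hkm
    have h1 : j + 1 - 2 = j - 1 := by omega
    have h2 : j + 1 - 3 = j - 2 := by omega
    rw [h1, h2] at ih
    refine Nat.eq_of_mul_eq_mul_left (by omega : 0 < j - 1) ?_
    calc (j - 1) * ((Lam (m + 1) j k).card * ((k - 1) * (k - 2) * m))
        = ((Lam (m + 1) j k).card * (j - 1)) * ((k - 1) * (k - 2) * m) := by ring
      _ = (j - 3) * ((Lam (m + 1) (j + 1) k).card * ((k - 1) * (k - 2) * m)) := by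
        rw [hs]; ring
      _ = _ := by rw [ih]; ring

lemma pairwiseDisjoint_Lam {m r : ℕ} (hr : 3 ≤ r) :
    ((Finset.Icc r m : Finset ℕ) : Set ℕ).PairwiseDisjoint (Lam (m + 1) r) := by
  have aux : ∀ k l, r ≤ k → k < l → l ≤ m →
      Disjoint (Lam (m + 1) r k) (Lam (m + 1) r l) := by
    intro k l hrk hkl hlm
    refine Finset.disjoint_left.2 fun x hx hy => ?_
    rw [mem_Lam] at hx hy
    refine hy.2.2 (k + 1) hkl (by omega) ?_
    rw [Nat.add_sub_cancel]
    exact hx.2.1.of_univ (get_mem_pre x (by omega) (by omega) (by omega))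
      (get_mem_pre x (by omega) le_rfl (by omega))
  intro k hk l hl hkl
  simp only [Finset.coe_Icc, Set.mem_Icc] at hk hl
  rcases lt_or_gt_of_ne hkl with h | h
  · exact aux k l hk.1 h hl.2
  · exact (aux l k hl.1 h hk.2).symm

lemma sum_Icc_one_div {r m : ℕ} (hr : 3 ≤ r) (hrm : r ≤ m) :
    ∑ k ∈ Finset.Icc r m, 1 / (((k : ℝ) - 1) * ((k : ℝ) - 2))
      = 1 / ((r : ℝ) - 2) - 1 / ((m : ℝ) - 1) := by
  have hr' : (3 : ℝ) ≤ r := by exact_mod_cast hr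
  induction m, hrm using Nat.le_induction with
  | base =>
    rw [Finset.Icc_self, Finset.sum_singleton]
    have h1 : (r : ℝ) - 2 ≠ 0 := by linarith
    have h2 : (r : ℝ) - 1 ≠ 0 := by linarith
    field_simp
    ring
  | succ m hm ih =>
    have hm' : (r : ℝ) ≤ m := by exact_mod_cast hm
    rw [Finset.sum_Icc_succ_top (by omega), ih]
    have h1 : (r : ℝ) - 2 ≠ 0 := by linarith
    have h2 : (m : ℝ) - 1 ≠ 0 := by linarith
    have h3 : (m : ℝ) ≠ 0 := by linarith
    have h4 : (m : ℝ) + 1 - 1 = m := by ring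
    have h5 : (m : ℝ) + 1 - 2 = m - 1 := by ring
    push_cast
    rw [h4, h5]
    field_simp
    ring

lemma card_LamU_div {n r : ℕ} (hr : 3 ≤ r) (hrn : r + 1 ≤ n) :
    ((LamU n r).card : ℝ) / (n.factorial : ℝ)
      = 2 * ((r : ℝ) - 3) * ((n : ℝ) - r) / (((n : ℝ) - 1) * ((n : ℝ) - 2)) := by
  obtain ⟨m, rfl⟩ : ∃ m, n = m + 1 := ⟨n - 1, by omega⟩
  have hr' : (3 : ℝ) ≤ r := by exact_mod_cast hr
  have hm' : (r : ℝ) ≤ m := by exact_mod_cast (by omega : r ≤ m)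
  have hf : ((m + 1).factorial : ℝ) ≠ 0 := by exact_mod_cast (m + 1).factorial_ne_zero
  have hterm : ∀ k ∈ Finset.Icc r m, ((Lam (m + 1) r k).card : ℝ)
      = (2 * ((m + 1).factorial : ℝ) * (((r : ℝ) - 2) * ((r : ℝ) - 3)) / m)
        * (1 / (((k : ℝ) - 1) * ((k : ℝ) - 2))) := by
    intro k hk
    rw [Finset.mem_Icc] at hk
    have hk' : (r : ℝ) ≤ k := by exact_mod_cast hk.1
    have h := card_Lam hr (by omega : r ≤ k + 1) (by omega) hk.2
    have h' := congrArg (Nat.cast : ℕ → ℝ) h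
    push_cast [Nat.cast_sub (by omega : 1 ≤ k), Nat.cast_sub (by omega : 2 ≤ k),
      Nat.cast_sub (by omega : 2 ≤ r), Nat.cast_sub (by omega : 3 ≤ r)] at h'
    have h1 : (k : ℝ) - 1 ≠ 0 := by linarith
    have h2 : (k : ℝ) - 2 ≠ 0 := by linarith
    have h3 : (m : ℝ) ≠ 0 := by linarith
    rw [div_mul_div_comm, mul_one, eq_div_iff (by positivity)]
    linarith
  have hcard : ((LamU (m + 1) r).card : ℝ)
      = ∑ k ∈ Finset.Icc r m, ((Lam (m + 1) r k).card : ℝ) := by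
    unfold LamU
    rw [Nat.add_sub_cancel, Finset.card_biUnion (pairwiseDisjoint_Lam hr)]
    push_cast
    rfl
  rw [hcard, Finset.sum_congr rfl hterm, ← Finset.mul_sum, sum_Icc_one_div hr (by omega)]
  have h1 : (r : ℝ) - 2 ≠ 0 := by linarith
  have h2 : (m : ℝ) - 1 ≠ 0 := by linarith
  have h3 : (m : ℝ) ≠ 0 := by linarith
  have h4 : (m : ℝ) + 1 - 1 = m := by ring
  have h5 : (m : ℝ) + 1 - 2 = m - 1 := by ring
  push_cast
  rw [h4, h5]
  field_simp
  ring

/-- for real `0 < α < 1`,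
`lim_{n→∞} |Λ_n(⌊αn⌋)| / n! = 2α − 2α²`. -/
theorem statement8 (α : ℝ) (h0 : 0 < α) (h1 : α < 1) :
    Filter.Tendsto (fun n : ℕ =>
        ((LamU n ⌊α * n⌋₊).card : ℝ) / (Nat.factorial n : ℝ))
      Filter.atTop (nhds (2 * α - 2 * α ^ 2)) := by
  have hfl : Filter.Tendsto (fun n : ℕ => (⌊α * n⌋₊ : ℝ) / n) Filter.atTop (nhds α) :=
    (tendsto_nat_floor_mul_div_atTop h0.le).comp tendsto_natCast_atTop_atTop
  have hinv : ∀ c : ℝ, Filter.Tendsto (fun n : ℕ => c / (n : ℝ)) Filter.atTop (nhds 0) :=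
    fun c => tendsto_const_div_atTop_nhds_zero_nat c
  have hlim : Filter.Tendsto (fun n : ℕ =>
      2 * ((⌊α * n⌋₊ : ℝ) / n - 3 / n) * (1 - (⌊α * n⌋₊ : ℝ) / n)
        / ((1 - 1 / (n : ℝ)) * (1 - 2 / (n : ℝ))))
      Filter.atTop (nhds (2 * (α - 0) * (1 - α) / ((1 - 0) * (1 - 0)))) :=
    (((hfl.sub (hinv 3)).const_mul 2).mul (hfl.const_sub 1)).div
      (((hinv 1).const_sub 1).mul ((hinv 2).const_sub 1)) (by norm_num)
  have hval : 2 * (α - 0) * (1 - α) / ((1 - 0) * (1 - 0)) = 2 * α - 2 * α ^ 2 := by ring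
  rw [hval] at hlim
  refine hlim.congr' ?_
  have e1 : ∀ᶠ n : ℕ in Filter.atTop, 3 / α ≤ (n : ℝ) :=
    tendsto_natCast_atTop_atTop.eventually_ge_atTop _
  have e2 : ∀ᶠ n : ℕ in Filter.atTop, 1 / (1 - α) ≤ (n : ℝ) :=
    tendsto_natCast_atTop_atTop.eventually_ge_atTop _
  filter_upwards [e1, e2] with n hn1 hn2
  rw [div_le_iff₀ h0] at hn1
  rw [div_le_iff₀ (by linarith)] at hn2
  have hr : 3 ≤ ⌊α * n⌋₊ := Nat.le_floor (by push_cast; linarith)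
  have hle : (⌊α * n⌋₊ : ℝ) ≤ α * n := Nat.floor_le (by positivity)
  have hrn : ⌊α * n⌋₊ + 1 ≤ n := by
    have : (⌊α * n⌋₊ : ℝ) + 1 ≤ n := by linarith
    exact_mod_cast this
  rw [card_LamU_div hr hrn]
  have hn4 : (4 : ℝ) ≤ n := by exact_mod_cast (by omega : 4 ≤ n)
  have a1 : (n : ℝ) ≠ 0 := by linarith
  have a2 : (n : ℝ) - 1 ≠ 0 := by linarith
  have a3 : (n : ℝ) - 2 ≠ 0 := by linarith
  field_simp
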